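/- Let b > 1 and r > 1. The sequence (δ_{x_n}^{u_n})_{n∈ℕ}, with x_{n,j} = b^{(2j−1)/(2n)} for all n ∈ ℕ and j = 1,…,n, is a sequence of asymptotically best uniform d_r-approximations of the Benford measure β_b; that is, lim_{n→∞} d_r(β_b, δ_{x_n}^{u_n}) / min_{x∈Ξ_n} d_r(β_b, δ_x^{u_n}) = 1. Moreover, lim_{n→∞} n · min_{x∈Ξ_n} d_r(β_b, δ_x^{u_n}) = (log b)^{1−1/r}/(2(b−1)) · ((b^r − 1)/(r(r+1)))^{1/r}. -/

import Mathlib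

open MeasureTheory Filter Set

noncomputable section

namespace BenfordApprox

/-- Right-hand limit `f₊` of a nondecreasing `f : ℝ → ℝ̄`, at an extended-real point. -/
def fplus (f : ℝ → EReal) (a : EReal) : EReal := sInf (f '' {x : ℝ | a < (x : EReal)})

/-- Left-hand limit `f₋` of a nondecreasing `f : ℝ → ℝ̄`, at an extended-real point. -/
def fminus (f : ℝ → EReal) (a : EReal) : EReal := sSup (f '' {x : ℝ | (x : EReal) < a})

/-- The (upper) inverse function `f⁻¹(t) = sup {x : f x ≤ t}` (with `sup ∅ = ⊥`). -/
def upperInv (f : ℝ → EReal) (t : ℝ) : EReal :=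
  sSup ((fun x : ℝ => (x : EReal)) '' {x : ℝ | f x ≤ (t : EReal)})

/-- The upper inverse, for an extended-real argument. -/
def upperInvE (f : ℝ → EReal) (t : EReal) : EReal :=
  sSup ((fun x : ℝ => (x : EReal)) '' {x : ℝ | f x ≤ t})

/-- Lévy-type distance `d_L(f,g)` between nondecreasing functions `f g : ℝ → ℝ̄`. -/
def dLfun (f g : ℝ → EReal) : EReal :=
  sInf ((fun y : ℝ => (y : EReal)) ''
    {y : ℝ | 0 ≤ y ∧ ∀ x : ℝ, f (x - y) - (y : EReal) ≤ g x ∧ g x ≤ f (x + y) + (y : EReal)})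

/-- The auxiliary function `ℓ_{f,I}`; it depends on `I` only through `lo = inf I`, `hi = sup I`. -/
def ell (f : ℝ → EReal) (lo hi : EReal) (x : ℝ) : ℝ :=
  sInf {y : ℝ | 0 ≤ y ∧ fminus f (hi - (y : EReal)) - (y : EReal) ≤ (x : EReal) ∧
    (x : EReal) ≤ fplus f (lo + (y : EReal)) + (y : EReal)}

/-- The minimal value `ℓ*_{f,I} = min {y ≥ 0 : f₋(sup I − y) − y ≤ f₊(inf I + y) + y}`. -/
def ellStar (f : ℝ → EReal) (lo hi : EReal) : ℝ :=
  sInf {y : ℝ | 0 ≤ y ∧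
    fminus f (hi - (y : EReal)) - (y : EReal) ≤ fplus f (lo + (y : EReal)) + (y : EReal)}

/-- Distribution function `F_μ(t) = μ {y ∈ 𝕀 : y ≤ t}` of `μ`, where `𝕀 = [A,B]`. -/
def cdf (μ : Measure ℝ) (A B : ℝ) (t : ℝ) : ℝ := (μ (Icc A B ∩ Iic t)).toReal

/-- `F_μ` evaluated at an extended-real point (so `F_μ(−∞) = 0`, `F_μ(+∞) = 1`). -/
def cdfE (μ : Measure ℝ) (A B : ℝ) (a : EReal) : ℝ :=
  (μ (Icc A B ∩ {y : ℝ | (y : EReal) ≤ a})).toReal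

/-- Left limit `F_{μ−}` at an extended-real point (so `F_{μ−}(−∞) = 0`, `F_{μ−}(+∞) = 1`). -/
def cdfL (μ : Measure ℝ) (A B : ℝ) (a : EReal) : ℝ :=
  sSup ((cdf μ A B) '' {t : ℝ | (t : EReal) < a})

/-- Left limit `F_{μ−}` at a real point. -/
def cdfm (μ : Measure ℝ) (A B : ℝ) (t : ℝ) : ℝ := sSup ((cdf μ A B) '' Iio t)

/-- The (upper) quantile function `F_μ⁻¹` of `μ` on `𝕀 = [A,B]`, extended monotonically to `ℝ`. -/
def quant (μ : Measure ℝ) (A B : ℝ) (t : ℝ) : ℝ :=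
  if t < (μ {A}).toReal ∨ t < 0 then A
  else sSup {y ∈ Icc A B | cdf μ A B y ≤ t}

/-- Left limit `F⁻¹_{μ−}` of the quantile function. -/
def quantm (μ : Measure ℝ) (A B : ℝ) (t : ℝ) : ℝ := sSup ((quant μ A B) '' Iio t)

/-- `F_μ` as a function into the extended reals. -/
def cdfEReal (μ : Measure ℝ) (A B : ℝ) : ℝ → EReal := fun t => ((cdf μ A B t : ℝ) : EReal)

/-- `F_μ⁻¹` as a function into the extended reals. -/
def quantEReal (μ : Measure ℝ) (A B : ℝ) : ℝ → EReal := fun t => ((quant μ A B t : ℝ) : EReal)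

/-- The finitely supported measure `δ_x^p = Σ_j p_j δ_{x_j}`. -/
def discr (n : ℕ) (x p : Fin n → ℝ) : Measure ℝ :=
  ∑ j : Fin n, ENNReal.ofReal (p j) • Measure.dirac (x j)

/-- `p ∈ Π_n`: a probability vector. -/
def IsPi (n : ℕ) (p : Fin n → ℝ) : Prop := (∀ j, 0 ≤ p j) ∧ ∑ j, p j = 1

/-- `x ∈ Ξ_n`: a nondecreasing vector of locations in `𝕀 = [A,B]`. -/
def IsXi (A B : ℝ) (n : ℕ) (x : Fin n → ℝ) : Prop := (∀ j, x j ∈ Icc A B) ∧ Monotone x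

/-- The uniform weight vector `u_n = (1/n, …, 1/n)`. -/
def unif (n : ℕ) : Fin n → ℝ := fun _ => 1 / (n : ℝ)

/-- Partial sums `P_i = Σ_{j<i} p_j` (so `P_0 = 0`, `P_n = 1`). -/
def psum (n : ℕ) (p : Fin n → ℝ) (i : ℕ) : ℝ := ∑ j : Fin n, if (j : ℕ) < i then p j else 0

/-- Locations extended by `x_0 = −∞`, `x_{n+1} = +∞`; here `extPts n x j` is the paper's `x_j`. -/
def extPts (n : ℕ) (x : Fin n → ℝ) : ℕ → EReal := fun j =>
  if hj : j = 0 then ⊥ else if h : j ≤ n then ((x ⟨j - 1, by omega⟩ : ℝ) : EReal) else ⊤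

/-- `xcoord n x j` is the paper's `x_{j+1}` (0-based access). -/
def xcoord (n : ℕ) (x : Fin n → ℝ) (j : ℕ) : ℝ := if h : j < n then x ⟨j, h⟩ else 0

/-- The normalizing constant `ω = max{1, λ(𝕀)}/λ(𝕀)` for `𝕀 = [A,B]`. -/
def omegaI (A B : ℝ) : ℝ := max 1 (B - A) / (B - A)

/-- Lévy distance between Borel measures on `𝕀 = [A,B]`. -/
def dLevy (A B : ℝ) (μ ν : Measure ℝ) : ℝ :=
  omegaI A B * sInf {y : ℝ | 0 ≤ y ∧
    ∀ t : ℝ, cdf μ A B (t - y) - y ≤ cdf ν A B t ∧ cdf ν A B t ≤ cdf μ A B (t + y) + y}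

/-- Kolmogorov (uniform) distance between Borel measures on `𝕀 = [A,B]`. -/
def dKol (A B : ℝ) (μ ν : Measure ℝ) : ℝ :=
  sSup (Set.range fun t : ℝ => |cdf μ A B t - cdf ν A B t|)

/-- `L¹`-Kantorovich distance between Borel measures on `𝕀 = [A,B]`. -/
def dKant1 (A B : ℝ) (μ ν : Measure ℝ) : ℝ :=
  (B - A)⁻¹ * ∫ y in Ioo (0 : ℝ) 1, |quant μ A B y - quant ν A B y|

/-- `L^r`-Kantorovich distance between Borel measures on `𝕀 = [A,B]`. -/
def dKant (A B r : ℝ) (μ ν : Measure ℝ) : ℝ :=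
  (B - A)⁻¹ * (∫ y in Ioo (0 : ℝ) 1, |quant μ A B y - quant ν A B y| ^ r) ^ (1 / r)

/-- The Benford measure `β_b` on `[1,b]`: the law of `b^U` with `U` uniform on `[0,1)`. -/
def benford (b : ℝ) : Measure ℝ := (volume.restrict (Ico (0 : ℝ) 1)).map (fun t : ℝ => b ^ t)

/-- The map `T_{f,a}(x) = f₊(f⁻¹(x+a) + 2a) + a`. -/
def Tmap (f : ℝ → EReal) (a : ℝ) : EReal → EReal :=
  fun x => fplus f (upperInvE f (x + (a : EReal)) + ((2 * a : ℝ) : EReal)) + (a : EReal)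

/-- The map `S_{f,a}(x) = f₊(f⁻¹(x+a)) + a`. -/
def Smap (f : ℝ → EReal) (a : ℝ) : EReal → EReal :=
  fun x => fplus f (upperInvE f (x + (a : EReal))) + (a : EReal)

/-- `L_•^{•,n} = min {a ≥ 0 : T_{F_μ,a}^{[n]}(0) ≥ 1}`. -/
def LBB (μ : Measure ℝ) (A B : ℝ) (n : ℕ) : ℝ :=
  sInf {a : ℝ | 0 ≤ a ∧ (1 : EReal) ≤ (Tmap (cdfEReal μ A B) a)^[n] ((0 : ℝ) : EReal)}

/-- `K_•^{•,n} = min {a ≥ 0 : S_{F_μ,a}^{[n]}(0) ≥ 1}`. -/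
def KBB (μ : Measure ℝ) (A B : ℝ) (n : ℕ) : ℝ :=
  sInf {a : ℝ | 0 ≤ a ∧ (1 : EReal) ≤ (Smap (cdfEReal μ A B) a)^[n] ((0 : ℝ) : EReal)}

theorem benford_apply {b : ℝ} {s : Set ℝ} (hb : 1 < b) (hs : MeasurableSet s) :
    benford b s = volume ((fun t : ℝ => b ^ t) ⁻¹' s ∩ Ico (0 : ℝ) 1) := by
  have hm : Measurable (fun t : ℝ => b ^ t) :=
    (Real.continuous_const_rpow (by linarith)).measurable
  rw [benford, Measure.map_apply hm hs, Measure.restrict_apply (hm hs)]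

theorem benford_singleton_one {b : ℝ} (hb : 1 < b) : benford b {1} = 0 := by
  rw [benford_apply hb (measurableSet_singleton 1)]
  refine measure_mono_null (t := {0}) ?_ (by simp)
  rintro t ⟨ht, -⟩
  have h : b ^ t = b ^ (0 : ℝ) := by simpa using ht
  exact (Real.strictMono_rpow_of_base_gt_one hb).injective h

theorem cdf_benford {b s : ℝ} (hb : 1 < b) (hs : s ∈ Icc (0 : ℝ) 1) :
    cdf (benford b) 1 b (b ^ s) = s := by
  have hmono := Real.strictMono_rpow_of_base_gt_one hb
  have hset : (fun t : ℝ => b ^ t) ⁻¹' (Icc 1 b ∩ Iic (b ^ s)) ∩ Ico (0 : ℝ) 1 =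
      Icc 0 s ∩ Ico (0 : ℝ) 1 := by
    ext t
    simp only [mem_inter_iff, mem_preimage, mem_Icc, mem_Iic, mem_Ico]
    rw [show b ^ t ≤ b ^ s ↔ t ≤ s from hmono.le_iff_le]
    constructor
    · rintro ⟨⟨-, h⟩, h'⟩
      exact ⟨⟨h'.1, h⟩, h'⟩
    · rintro ⟨⟨-, h⟩, h'⟩
      refine ⟨⟨⟨Real.one_le_rpow hb.le h'.1, ?_⟩, h⟩, h'⟩
      simpa using hmono.monotone h'.2.le
  rw [cdf, benford_apply hb (measurableSet_Icc.inter measurableSet_Iic), hset]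
  have hv : volume (Icc 0 s ∩ Ico (0 : ℝ) 1) = ENNReal.ofReal s := by
    apply le_antisymm
    · calc volume (Icc 0 s ∩ Ico (0 : ℝ) 1) ≤ volume (Icc 0 s) := measure_mono inter_subset_left
        _ = ENNReal.ofReal s := by simp
    · calc ENNReal.ofReal s = volume (Ico 0 s) := by simp
        _ ≤ volume (Icc 0 s ∩ Ico (0 : ℝ) 1) := by
          apply measure_mono
          intro t ht
          exact ⟨⟨ht.1, ht.2.le⟩, ht.1, ht.2.trans_le hs.2⟩
  rw [hv, ENNReal.toReal_ofReal hs.1]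

theorem quant_benford {b t : ℝ} (hb : 1 < b) (ht : t ∈ Ioo (0 : ℝ) 1) :
    quant (benford b) 1 b t = b ^ t := by
  have hb0 : 0 < b := by linarith
  have hmono := Real.strictMono_rpow_of_base_gt_one hb
  have hcond : ¬ (t < (benford b {1}).toReal ∨ t < 0) := by
    rw [benford_singleton_one hb]
    simpa using ht.1.le
  have hset : {y ∈ Icc 1 b | cdf (benford b) 1 b y ≤ t} = Icc 1 (b ^ t) := by
    ext y
    constructor
    · rintro ⟨hy, hc⟩
      obtain ⟨s, rfl⟩ : ∃ s, b ^ s = y :=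
        ⟨Real.logb b y, Real.rpow_logb hb0 hb.ne' (by linarith [hy.1])⟩
      have h0 : (0 : ℝ) ≤ s := hmono.le_iff_le.1 (by simpa using hy.1)
      have h1 : s ≤ 1 := hmono.le_iff_le.1 (by simpa using hy.2)
      rw [cdf_benford hb ⟨h0, h1⟩] at hc
      exact ⟨hy.1, hmono.monotone hc⟩
    · rintro ⟨hy, hc⟩
      obtain ⟨s, rfl⟩ : ∃ s, b ^ s = y :=
        ⟨Real.logb b y, Real.rpow_logb hb0 hb.ne' (by linarith)⟩
      have h0 : (0 : ℝ) ≤ s := hmono.le_iff_le.1 (by simpa using hy)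
      have h1 : s ≤ t := hmono.le_iff_le.1 hc
      have h2 : s ≤ 1 := h1.trans ht.2.le
      refine ⟨⟨hy, by simpa using hmono.monotone h2⟩, ?_⟩
      rwa [cdf_benford hb ⟨h0, h2⟩]
  rw [quant, if_neg hcond, hset, csSup_Icc (Real.one_le_rpow hb.le ht.1.le)]

open scoped Classical in
theorem discr_unif_toReal {n : ℕ} (y : Fin n → ℝ) {s : Set ℝ} (hs : MeasurableSet s) :
    (discr n y (unif n) s).toReal = (Finset.univ.filter fun j => y j ∈ s).card / (n : ℝ) := by
  have h : discr n y (unif n) s = ∑ j, if y j ∈ s then ENNReal.ofReal (1 / (n : ℝ)) else 0 := by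
    simp [discr, unif, Measure.finsetSum_apply, Measure.dirac_apply' _ hs, indicator_apply]
  rw [h, ← Finset.sum_filter, Finset.sum_const, nsmul_eq_mul, ENNReal.toReal_mul,
    ENNReal.toReal_ofReal (by positivity)]
  simp [div_eq_mul_inv]

open scoped Classical in
theorem lt_card_div_of_forall_mem {n : ℕ} {y : Fin n → ℝ} {s : Set ℝ}
    {j : Fin n} (hs : ∀ i ≤ j, y i ∈ s) {t : ℝ} (ht : t < ((j : ℝ) + 1) / n) :
    t < (Finset.univ.filter fun i => y i ∈ s).card / (n : ℝ) := by
  refine ht.trans_le ?_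
  have hc : (j : ℕ) + 1 ≤ (Finset.univ.filter fun i => y i ∈ s).card := by
    rw [← Fin.card_Iic j]
    apply Finset.card_le_card
    intro i hi
    simpa using hs i (by simpa using hi)
  gcongr
  exact_mod_cast hc

open scoped Classical in
theorem card_div_lt_of_forall_notMem {n : ℕ} {y : Fin n → ℝ} {s : Set ℝ}
    {j : Fin n} (hs : ∀ i, j ≤ i → y i ∉ s) {t : ℝ} (ht : (j : ℝ) / n < t) :
    (Finset.univ.filter fun i => y i ∈ s).card / (n : ℝ) < t := by
  refine lt_of_le_of_lt ?_ ht
  have hc : (Finset.univ.filter fun i => y i ∈ s).card ≤ (j : ℕ) := by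
    rw [← Fin.card_Iio j]
    apply Finset.card_le_card
    intro i hi
    by_contra hij
    exact hs i (by simpa using hij) (by simpa using hi)
  gcongr

theorem quant_discr_unif {n : ℕ} {A B : ℝ} {y : Fin n → ℝ} (hy : IsXi A B n y) (j : Fin n)
    {t : ℝ} (ht : t ∈ Ioo ((j : ℝ) / n) (((j : ℝ) + 1) / n)) :
    quant (discr n y (unif n)) A B t = y j := by
  classical
  have ht0 : 0 < t := lt_of_le_of_lt (by positivity) ht.1
  have hA := (hy.1 j).1
  rw [quant, discr_unif_toReal y (measurableSet_singleton A)]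
  rcases hA.eq_or_lt with hj | hj
  · rw [if_pos, hj]
    left
    apply lt_card_div_of_forall_mem (j := j) _ ht.2
    intro i hi
    exact le_antisymm ((hy.2 hi).trans hj.ge) (hy.1 i).1
  · rw [if_neg]
    · have hset : {z ∈ Icc A B | cdf (discr n y (unif n)) A B z ≤ t} = Ico A (y j) := by
        ext z
        simp only [cdf, discr_unif_toReal y (measurableSet_Icc.inter measurableSet_Iic),
          mem_ofPred_eq, mem_Ico]
        constructor
        · rintro ⟨hz, hc⟩
          refine ⟨hz.1, ?_⟩
          by_contra! hlt
          exact (lt_card_div_of_forall_mem (s := Icc A B ∩ Iic z) (j := j)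
            (fun i hi => ⟨hy.1 i, (hy.2 hi).trans hlt⟩) ht.2).not_ge hc
        · rintro ⟨hz, hlt⟩
          refine ⟨⟨hz, hlt.le.trans (hy.1 j).2⟩, ?_⟩
          exact (card_div_lt_of_forall_notMem (s := Icc A B ∩ Iic z) (j := j)
            (fun i hi h => (hlt.trans_le (hy.2 hi)).not_ge h.2) ht.1).le
      rw [hset, csSup_Ico hj]
    · rintro (h | h)
      · exact (card_div_lt_of_forall_notMem (s := {A}) (j := j)
          (fun i hi h => (hj.trans_le (hy.2 hi)).ne' h) ht.1).not_gt h
      · exact ht0.not_gt h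

theorem continuous_abs_rpow_sub_rpow {b r : ℝ} (hb : 1 < b) (hr : 0 < r) (c : ℝ) :
    Continuous fun t : ℝ => |b ^ t - c| ^ r :=
  (((Real.continuous_const_rpow (by linarith)).sub continuous_const).abs).rpow_const
    fun _ => Or.inr hr.le

theorem dKant_benford_discr_unif {b r : ℝ} (hb : 1 < b) (hr : 0 < r) {n : ℕ} (hn : n ≠ 0)
    {y : Fin n → ℝ} (hy : IsXi 1 b n y) :
    dKant 1 b r (benford b) (discr n y (unif n)) =
      (b - 1)⁻¹ * (∑ j : Fin n,
        ∫ t in ((j : ℝ) / n)..(((j : ℝ) + 1) / n), |b ^ t - y j| ^ r) ^ (1 / r) := by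
  have hn0 : (0 : ℝ) < n := by positivity
  set f : ℝ → ℝ := fun t => |quant (benford b) 1 b t - quant (discr n y (unif n)) 1 b t| ^ r
  have heq : ∀ j : Fin n, EqOn (fun t => |b ^ t - y j| ^ r) f
      (uIoo ((j : ℝ) / n) (((j : ℝ) + 1) / n)) := by
    intro j t ht
    rw [uIoo_of_le (by gcongr; linarith)] at ht
    have ht1 : t < 1 := by
      refine ht.2.trans_le ?_
      rw [div_le_one hn0]
      exact_mod_cast j.2
    have ht0 : 0 < t := lt_of_le_of_lt (by positivity) ht.1
    simp only [f]
    rw [quant_benford hb ⟨ht0, ht1⟩, quant_discr_unif hy j ht]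
  have hsum := intervalIntegral.sum_integral_adjacent_intervals (f := f) (μ := volume)
    (a := fun k : ℕ => (k : ℝ) / n) (n := n) fun k hk => by
      have h := ((continuous_abs_rpow_sub_rpow hb hr (y ⟨k, hk⟩)).intervalIntegrable (μ := volume)
        ((k : ℝ) / n) (((k : ℝ) + 1) / n)).congr_uIoo (heq ⟨k, hk⟩)
      simpa using h
  rw [Finset.sum_range] at hsum
  simp only [Nat.cast_zero, zero_div, div_self hn0.ne', Nat.cast_add, Nat.cast_one] at hsum
  rw [dKant, ← integral_Ioc_eq_integral_Ioo, ← intervalIntegral.integral_of_le zero_le_one, ← hsum]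
  congr 3
  ext j
  exact (intervalIntegral.integral_congr_uIoo (heq j)).symm

theorem integral_eq_integral_add_reflect {g : ℝ → ℝ} (hg : Continuous g) (m h : ℝ) :
    ∫ t in (m - h)..(m + h), g t = ∫ s in (0 : ℝ)..h, (g (m + s) + g (m - s)) := by
  rw [intervalIntegral.integral_add ((by fun_prop : Continuous _).intervalIntegrable _ _)
    ((by fun_prop : Continuous _).intervalIntegrable _ _),
    intervalIntegral.integral_comp_add_left, intervalIntegral.integral_comp_sub_left,
    add_zero, sub_zero, add_comm (∫ t in m..(m + h), g t),
    intervalIntegral.integral_add_adjacent_intervals (hg.intervalIntegrable _ _)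
      (hg.intervalIntegrable _ _)]

theorem integral_two_mul_mul_rpow {r K h : ℝ} (hr : 0 < r) (hK : 0 ≤ K) (hh : 0 ≤ h) :
    ∫ s in (0 : ℝ)..h, 2 * (K * s) ^ r = 2 * K ^ r * (h ^ (r + 1) / (r + 1)) := by
  have h1 : ∫ s in (0 : ℝ)..h, 2 * (K * s) ^ r = ∫ s in (0 : ℝ)..h, 2 * K ^ r * s ^ r := by
    apply intervalIntegral.integral_congr
    intro s hs
    rw [uIcc_of_le hh] at hs
    simp only
    rw [Real.mul_rpow hK hs.1]
    ring
  rw [h1, intervalIntegral.integral_const_mul, integral_rpow (Or.inl (by linarith)),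
    Real.zero_rpow (by linarith), sub_zero]

theorem two_mul_rpow_le_add_rpow {r u v w : ℝ} (hr : 1 ≤ r) (hw : 0 ≤ w) (hu : 0 ≤ u)
    (hv : 0 ≤ v) (h : 2 * w ≤ u + v) : 2 * w ^ r ≤ u ^ r + v ^ r := by
  have hc := (convexOn_rpow hr).2 (mem_Ici.2 hu) (mem_Ici.2 hv)
    (by norm_num : (0 : ℝ) ≤ 1 / 2) (by norm_num : (0 : ℝ) ≤ 1 / 2) (by norm_num)
  simp only [smul_eq_mul] at hc
  have hw' : w ^ r ≤ (1 / 2 * u + 1 / 2 * v) ^ r :=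
    Real.rpow_le_rpow hw (by linarith) (by linarith)
  linarith

theorem le_integral_abs_rpow_sub_rpow {b r h : ℝ} (hb : 1 < b) (hr : 1 ≤ r) (hh : 0 ≤ h)
    (m c : ℝ) :
    2 * (b ^ m * Real.log b) ^ r * (h ^ (r + 1) / (r + 1)) ≤
      ∫ t in (m - h)..(m + h), |b ^ t - c| ^ r := by
  have hb0 : 0 < b := by linarith
  have hl : 0 < Real.log b := Real.log_pos hb
  have hr0 : 0 < r := by linarith
  have hg := continuous_abs_rpow_sub_rpow hb hr0 c
  rw [integral_eq_integral_add_reflect hg, ← integral_two_mul_mul_rpow hr0 (by positivity) hh]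
  apply intervalIntegral.integral_mono_on hh
  · refine Continuous.intervalIntegrable ?_ _ _
    exact continuous_const.mul ((continuous_const.mul continuous_id).rpow_const
      fun _ => Or.inr hr0.le)
  · exact ((hg.comp (continuous_const.add continuous_id)).add
      (hg.comp (continuous_const.sub continuous_id))).intervalIntegrable _ _
  · intro s hs
    apply two_mul_rpow_le_add_rpow hr (mul_nonneg (by positivity) hs.1) (abs_nonneg _)
      (abs_nonneg _)
    have hsinh : Real.log b * s ≤ Real.sinh (Real.log b * s) :=
      Real.self_le_sinh_iff.2 (mul_nonneg hl.le hs.1)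
    have h1 : b ^ (m + s) - b ^ (m - s) = 2 * (b ^ m * Real.sinh (Real.log b * s)) := by
      rw [Real.rpow_add hb0, sub_eq_add_neg m s, Real.rpow_add hb0, Real.sinh_eq,
        Real.rpow_def_of_pos hb0 s, Real.rpow_def_of_pos hb0 (-s), mul_neg]
      ring
    calc 2 * (b ^ m * Real.log b * s) = 2 * (b ^ m * (Real.log b * s)) := by ring
      _ ≤ 2 * (b ^ m * Real.sinh (Real.log b * s)) := by gcongr
      _ = (b ^ (m + s) - c) - (b ^ (m - s) - c) := by rw [← h1]; ring
      _ ≤ _ := (le_abs_self _).trans (abs_sub _ _)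

theorem abs_rpow_sub_one_le {b s h : ℝ} (hb : 1 < b) (hs : |s| ≤ h) :
    |b ^ s - 1| ≤ b ^ h * Real.log b * |s| := by
  have hb0 : 0 < b := by linarith
  have hl : 0 < Real.log b := Real.log_pos hb
  have h0 : 0 ≤ h := (abs_nonneg s).trans hs
  have h1 : 1 ≤ b ^ h := Real.one_le_rpow hb.le h0
  rcases le_total 0 s with hs0 | hs0
  · rw [abs_of_nonneg hs0] at hs ⊢
    rw [abs_of_nonneg (sub_nonneg.2 (Real.one_le_rpow hb.le hs0))]
    have h2 : -(Real.log b * s) + 1 ≤ b ^ (-s) := by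
      rw [Real.rpow_def_of_pos hb0, mul_neg]
      exact Real.add_one_le_exp _
    have h3 : b ^ s * b ^ (-s) = 1 := by rw [← Real.rpow_add hb0]; simp
    calc b ^ s - 1 ≤ b ^ s * (Real.log b * s) := by
          nlinarith [Real.rpow_pos_of_pos hb0 s]
      _ ≤ b ^ h * (Real.log b * s) := by gcongr; exact hb.le
      _ = _ := by ring
  · rw [abs_of_nonpos hs0]
    rw [abs_of_nonpos (sub_nonpos.2 (Real.rpow_le_one_of_one_le_of_nonpos hb.le hs0))]
    have h2 : Real.log b * s + 1 ≤ b ^ s := by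
      rw [Real.rpow_def_of_pos hb0]
      exact Real.add_one_le_exp _
    have h3 : 0 ≤ Real.log b * -s := mul_nonneg hl.le (by linarith)
    nlinarith

theorem integral_abs_rpow_sub_midpoint_le {b r h : ℝ} (hb : 1 < b) (hr : 0 < r) (hh : 0 ≤ h)
    (m : ℝ) :
    ∫ t in (m - h)..(m + h), |b ^ t - b ^ m| ^ r ≤
      (b ^ h) ^ r * (2 * (b ^ m * Real.log b) ^ r * (h ^ (r + 1) / (r + 1))) := by
  have hb0 : 0 < b := by linarith
  have hl : 0 < Real.log b := Real.log_pos hb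
  have hg := continuous_abs_rpow_sub_rpow hb hr (b ^ m)
  have hK : (b ^ h) ^ r * (2 * (b ^ m * Real.log b) ^ r * (h ^ (r + 1) / (r + 1))) =
      2 * (b ^ h * (b ^ m * Real.log b)) ^ r * (h ^ (r + 1) / (r + 1)) := by
    rw [Real.mul_rpow (x := b ^ h) (by positivity) (by positivity)]
    ring
  rw [hK, integral_eq_integral_add_reflect hg, ← integral_two_mul_mul_rpow hr (by positivity) hh]
  apply intervalIntegral.integral_mono_on hh
  · exact ((hg.comp (continuous_const.add continuous_id)).add
      (hg.comp (continuous_const.sub continuous_id))).intervalIntegrable _ _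
  · refine Continuous.intervalIntegrable ?_ _ _
    exact continuous_const.mul ((continuous_const.mul continuous_id).rpow_const
      fun _ => Or.inr hr.le)
  · intro s hs
    have key : ∀ u : ℝ, |u| = s → |b ^ (m + u) - b ^ m| ^ r ≤
        (b ^ h * (b ^ m * Real.log b) * s) ^ r := by
      intro u hu
      apply Real.rpow_le_rpow (abs_nonneg _) _ hr.le
      calc |b ^ (m + u) - b ^ m| = b ^ m * |b ^ u - 1| := by
            rw [Real.rpow_add hb0, ← mul_sub_one, abs_mul, abs_of_pos (Real.rpow_pos_of_pos hb0 m)]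
        _ ≤ b ^ m * (b ^ h * Real.log b * |u|) := by
            gcongr
            exact abs_rpow_sub_one_le hb (hu.trans_le hs.2)
        _ = _ := by rw [hu]; ring
    have k1 := key s (abs_of_nonneg hs.1)
    have k2 := key (-s) (by rw [abs_neg, abs_of_nonneg hs.1])
    rw [← sub_eq_add_neg] at k2
    linarith

/-- A lower bound for the `d_r`-distance of `β_b` to every measure `δ_x^{u_n}`. -/
def lowerBound (b r : ℝ) (n : ℕ) : ℝ :=
  (b - 1)⁻¹ * (∑ j : Fin n, 2 * (b ^ ((2 * (j : ℝ) + 1) / (2 * (n : ℝ))) * Real.log b) ^ r *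
    ((1 / (2 * (n : ℝ))) ^ (r + 1) / (r + 1))) ^ (1 / r)

theorem midpoint_sub_add {n : ℕ} (hn : n ≠ 0) (j : ℝ) :
    j / n = (2 * j + 1) / (2 * (n : ℝ)) - 1 / (2 * (n : ℝ)) ∧
      (j + 1) / n = (2 * j + 1) / (2 * (n : ℝ)) + 1 / (2 * (n : ℝ)) := by
  have hn0 : (n : ℝ) ≠ 0 := by exact_mod_cast hn
  constructor <;> field_simp <;> ring

theorem lowerBound_le {b r : ℝ} (hb : 1 < b) (hr : 1 < r) {n : ℕ} (hn : n ≠ 0)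
    {y : Fin n → ℝ} (hy : IsXi 1 b n y) :
    lowerBound b r n ≤ dKant 1 b r (benford b) (discr n y (unif n)) := by
  have hl : 0 < Real.log b := Real.log_pos hb
  have hb0 : 0 < b := by linarith
  rw [dKant_benford_discr_unif hb (by linarith) hn hy, lowerBound]
  refine mul_le_mul_of_nonneg_left ?_ (inv_nonneg.2 (by linarith))
  refine Real.rpow_le_rpow (Finset.sum_nonneg fun j _ => by positivity) ?_ (by positivity)
  refine Finset.sum_le_sum fun j _ => ?_
  rw [(midpoint_sub_add hn j).1, (midpoint_sub_add hn j).2]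
  exact le_integral_abs_rpow_sub_rpow hb hr.le (by positivity) _ _

theorem isXi_midpoints {b : ℝ} (hb : 1 < b) (n : ℕ) :
    IsXi 1 b n fun j : Fin n => b ^ ((2 * (j : ℝ) + 1) / (2 * (n : ℝ))) := by
  refine ⟨fun j => ⟨Real.one_le_rpow hb.le (by positivity), ?_⟩, fun i j hij => ?_⟩
  · have hn : (0 : ℝ) < n := by exact_mod_cast j.pos
    have hj : (j : ℝ) + 1 ≤ n := by exact_mod_cast j.2
    calc b ^ ((2 * (j : ℝ) + 1) / (2 * (n : ℝ))) ≤ b ^ (1 : ℝ) := by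
          apply Real.rpow_le_rpow_of_exponent_le hb.le
          rw [div_le_one (by positivity)]
          linarith
      _ = b := Real.rpow_one b
  · apply Real.rpow_le_rpow_of_exponent_le hb.le
    have : (i : ℝ) ≤ j := by exact_mod_cast hij
    gcongr

theorem dKant_midpoints_le {b r : ℝ} (hb : 1 < b) (hr : 1 < r) {n : ℕ} (hn : n ≠ 0) :
    dKant 1 b r (benford b)
        (discr n (fun j : Fin n => b ^ ((2 * (j : ℝ) + 1) / (2 * (n : ℝ)))) (unif n)) ≤
      b ^ (1 / (2 * (n : ℝ))) * lowerBound b r n := by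
  have hl : 0 < Real.log b := Real.log_pos hb
  have hb0 : 0 < b := by linarith
  have hr0 : 0 < r := by linarith
  rw [dKant_benford_discr_unif hb hr0 hn (isXi_midpoints hb n), lowerBound, mul_left_comm]
  refine mul_le_mul_of_nonneg_left ?_ (inv_nonneg.2 (by linarith))
  have hpow : b ^ (1 / (2 * (n : ℝ))) = ((b ^ (1 / (2 * (n : ℝ)))) ^ r) ^ (1 / r) := by
    rw [one_div r, Real.rpow_rpow_inv (by positivity) hr0.ne']
  rw [hpow, ← Real.mul_rpow (by positivity) (Finset.sum_nonneg fun j _ => by positivity)]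
  refine Real.rpow_le_rpow (Finset.sum_nonneg fun j _ => ?_) ?_ (by positivity)
  · refine intervalIntegral.integral_nonneg (by gcongr; linarith) fun t _ => by positivity
  rw [Finset.mul_sum]
  refine Finset.sum_le_sum fun j _ => ?_
  rw [(midpoint_sub_add hn j).1, (midpoint_sub_add hn j).2]
  exact integral_abs_rpow_sub_midpoint_le hb hr0 (by positivity) _

theorem tendsto_one_div_two_mul :
    Tendsto (fun n : ℕ => 1 / (2 * (n : ℝ))) atTop (nhds 0) := by
  have h := (tendsto_one_div_atTop_nhds_zero_nat (𝕜 := ℝ)).const_mul (1 / 2)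
  rw [mul_zero] at h
  refine h.congr fun n => ?_
  rw [one_div_mul_one_div]

theorem tendsto_rpow_one_div_two_mul {b : ℝ} (hb : 0 < b) :
    Tendsto (fun n : ℕ => b ^ (1 / (2 * (n : ℝ)))) atTop (nhds 1) := by
  have h := (Real.continuous_const_rpow hb.ne').continuousAt.tendsto.comp tendsto_one_div_two_mul
  rwa [Real.rpow_zero] at h

theorem tendsto_midpoint_sum {q : ℝ} (hq : 1 < q) :
    Tendsto (fun n : ℕ => 1 / (n : ℝ) * ∑ j : Fin n, q ^ ((2 * (j : ℝ) + 1) / (2 * (n : ℝ))))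
      atTop (nhds ((q - 1) / Real.log q)) := by
  have hq0 : 0 < q := by linarith
  have hlog : Tendsto (fun n : ℕ => (n : ℝ) * (q ^ (1 / (n : ℝ)) - 1)) atTop
      (nhds (Real.log q)) := by
    have hz : Tendsto (fun n : ℕ => 1 / (n : ℝ)) atTop (nhdsWithin 0 (Ioi 0)) := by
      refine tendsto_nhdsWithin_iff.2 ⟨tendsto_one_div_atTop_nhds_zero_nat, ?_⟩
      filter_upwards [eventually_gt_atTop 0] with n hn
      have : (0 : ℝ) < n := by exact_mod_cast hn
      exact mem_Ioi.2 (by positivity)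
    refine ((tendsto_rpow_sub_one_log hq0).comp hz).congr fun n => ?_
    simp
  have h := ((tendsto_rpow_one_div_two_mul hq0).mul_const (q - 1)).div hlog (Real.log_pos hq).ne'
  rw [one_mul] at h
  refine h.congr' ?_
  filter_upwards [eventually_gt_atTop 0] with n hn
  have hn0 : (0 : ℝ) < n := by exact_mod_cast hn
  have hne : q ^ (1 / (n : ℝ)) ≠ 1 := (Real.one_lt_rpow hq (by positivity)).ne'
  have hterm : ∀ j : ℕ, q ^ ((2 * (j : ℝ) + 1) / (2 * (n : ℝ))) =
      q ^ (1 / (2 * (n : ℝ))) * (q ^ (1 / (n : ℝ))) ^ j := by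
    intro j
    rw [← Real.rpow_natCast, ← Real.rpow_mul hq0.le, ← Real.rpow_add hq0]
    congr 1
    field_simp
    ring
  have hpow : (q ^ (1 / (n : ℝ))) ^ n = q := by
    rw [one_div]
    exact Real.rpow_inv_natCast_pow hq0.le hn.ne'
  simp only [Pi.div_apply]
  rw [Fin.sum_univ_eq_sum_range (fun j : ℕ => q ^ ((2 * (j : ℝ) + 1) / (2 * (n : ℝ)))) n,
    Finset.sum_congr rfl fun j _ => hterm j, ← Finset.mul_sum, geom_sum_eq hne, hpow]
  have := sub_ne_zero.2 hne
  field_simp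

theorem mul_lowerBound {b r : ℝ} (hb : 1 < b) (hr : 1 < r) {n : ℕ} (hn : n ≠ 0) :
    (n : ℝ) * lowerBound b r n = (b - 1)⁻¹ * (Real.log b ^ r / ((r + 1) * 2 ^ r) *
      (1 / (n : ℝ) * ∑ j : Fin n, (b ^ r) ^ ((2 * (j : ℝ) + 1) / (2 * (n : ℝ))))) ^ (1 / r) := by
  have hl : 0 < Real.log b := Real.log_pos hb
  have hb0 : 0 < b := by linarith
  have hr0 : 0 < r := by linarith
  have hn0 : (0 : ℝ) < n := by positivity
  have hpow : (n : ℝ) = ((n : ℝ) ^ r) ^ (1 / r) := by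
    rw [one_div r, Real.rpow_rpow_inv hn0.le hr0.ne']
  rw [lowerBound, mul_left_comm]
  nth_rewrite 1 [hpow]
  rw [← Real.mul_rpow (by positivity) (Finset.sum_nonneg fun j _ => by positivity)]
  congr 2
  rw [Finset.mul_sum, Finset.mul_sum, Finset.mul_sum]
  refine Finset.sum_congr rfl fun j _ => ?_
  rw [Real.mul_rpow (by positivity) hl.le, ← Real.rpow_mul hb0.le, ← Real.rpow_mul hb0.le,
    mul_comm r, Real.rpow_add_one (by positivity), one_div (2 * (n : ℝ)),
    Real.inv_rpow (by positivity), Real.mul_rpow (by positivity) hn0.le]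
  field_simp

theorem tendsto_mul_lowerBound {b r : ℝ} (hb : 1 < b) (hr : 1 < r) :
    Tendsto (fun n : ℕ => (n : ℝ) * lowerBound b r n) atTop
      (nhds (Real.log b ^ (1 - 1 / r) / (2 * (b - 1)) *
        ((b ^ r - 1) / (r * (r + 1))) ^ (1 / r))) := by
  have hl : 0 < Real.log b := Real.log_pos hb
  have hb0 : 0 < b := by linarith
  have hr0 : 0 < r := by linarith
  have hq : 1 < b ^ r := Real.one_lt_rpow hb hr0
  have hb1 : b - 1 ≠ 0 := by linarith
  have h := (((tendsto_midpoint_sum hq).const_mul (Real.log b ^ r / ((r + 1) * 2 ^ r))).rpow_const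
    (p := 1 / r) (Or.inr (by positivity))).const_mul (b - 1)⁻¹
  have hC : (b - 1)⁻¹ * (Real.log b ^ r / ((r + 1) * 2 ^ r) *
      ((b ^ r - 1) / Real.log (b ^ r))) ^ (1 / r) = Real.log b ^ (1 - 1 / r) / (2 * (b - 1)) *
        ((b ^ r - 1) / (r * (r + 1))) ^ (1 / r) := by
    have hX : (Real.log b ^ (1 - 1 / r) / 2) ^ r = Real.log b ^ r / Real.log b / 2 ^ r := by
      rw [Real.div_rpow (by positivity) (by norm_num), ← Real.rpow_mul hl.le,
        ← Real.rpow_sub_one hl.ne']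
      congr 2
      field_simp
    have hY : Real.log b ^ r / ((r + 1) * 2 ^ r) * ((b ^ r - 1) / Real.log (b ^ r)) =
        (Real.log b ^ (1 - 1 / r) / 2) ^ r * ((b ^ r - 1) / (r * (r + 1))) := by
      rw [hX, Real.log_rpow hb0]
      field_simp
    have hq' : 0 < b ^ r - 1 := by linarith
    rw [hY, Real.mul_rpow (by positivity) (by positivity), one_div r,
      Real.rpow_rpow_inv (by positivity) hr0.ne']
    field_simp
  rw [hC] at h
  refine h.congr' ?_
  filter_upwards [eventually_ne_atTop 0] with n hn
  exact (mul_lowerBound hb hr hn).symm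

theorem lowerBound_pos {b r : ℝ} (hb : 1 < b) (hr : 1 < r) {n : ℕ} (hn : n ≠ 0) :
    0 < lowerBound b r n := by
  have hl : 0 < Real.log b := Real.log_pos hb
  have hb0 : 0 < b := by linarith
  have hn0 : (0 : ℝ) < n := by positivity
  have : Nonempty (Fin n) := ⟨⟨0, Nat.pos_of_ne_zero hn⟩⟩
  refine mul_pos (inv_pos.2 (by linarith)) (Real.rpow_pos_of_pos ?_ _)
  exact Finset.sum_pos (fun j _ => by positivity) Finset.univ_nonempty

/-- Prop. 4.5: `x_{n,j} = b^{(2j−1)/(2n)}` gives asymptotically best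
uniform `d_r`-approximations of the Benford measure `β_b`, and the uniform
`d_r`-quantization coefficient of `β_b`. -/
theorem asymp_best_uniform_dKant_benford (b r : ℝ) (hb : 1 < b) (hr : 1 < r) :
    Filter.Tendsto
      (fun n : ℕ =>
        dKant 1 b r (benford b)
            (discr n (fun j : Fin n => b ^ ((2 * (j : ℝ) + 1) / (2 * (n : ℝ)))) (unif n)) /
          sInf {c : ℝ | ∃ y : Fin n → ℝ, IsXi 1 b n y ∧
            c = dKant 1 b r (benford b) (discr n y (unif n))})
      Filter.atTop (nhds 1) ∧
    Filter.Tendsto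
      (fun n : ℕ => (n : ℝ) * sInf {c : ℝ | ∃ y : Fin n → ℝ, IsXi 1 b n y ∧
        c = dKant 1 b r (benford b) (discr n y (unif n))})
      Filter.atTop
      (nhds (Real.log b ^ (1 - 1 / r) / (2 * (b - 1)) *
        ((b ^ r - 1) / (r * (r + 1))) ^ (1 / r))) := by
  have hb0 : 0 < b := by linarith
  set d : ℕ → ℝ := fun n => dKant 1 b r (benford b)
    (discr n (fun j : Fin n => b ^ ((2 * (j : ℝ) + 1) / (2 * (n : ℝ)))) (unif n))
  set e : ℕ → ℝ := fun n => sInf {c : ℝ | ∃ y : Fin n → ℝ, IsXi 1 b n y ∧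
    c = dKant 1 b r (benford b) (discr n y (unif n))}
  have hLe : ∀ n : ℕ, n ≠ 0 → lowerBound b r n ≤ e n := fun n hn =>
    le_csInf ⟨d n, _, isXi_midpoints hb n, rfl⟩ fun c ⟨y, hy, hc⟩ => hc ▸ lowerBound_le hb hr hn hy
  have hed : ∀ n : ℕ, n ≠ 0 → e n ≤ d n := fun n hn =>
    csInf_le ⟨lowerBound b r n, fun c ⟨y, hy, hc⟩ => hc ▸ lowerBound_le hb hr hn hy⟩
      ⟨_, isXi_midpoints hb n, rfl⟩
  have hdL : ∀ n : ℕ, n ≠ 0 → d n ≤ b ^ (1 / (2 * (n : ℝ))) * lowerBound b r n := fun n hn =>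
    dKant_midpoints_le hb hr hn
  have hone := tendsto_rpow_one_div_two_mul hb0
  have hlim := tendsto_mul_lowerBound hb hr
  constructor
  · refine tendsto_of_tendsto_of_tendsto_of_le_of_le' tendsto_const_nhds hone ?_ ?_
    · filter_upwards [eventually_ne_atTop 0] with n hn
      exact (one_le_div ((lowerBound_pos hb hr hn).trans_le (hLe n hn))).2 (hed n hn)
    · filter_upwards [eventually_ne_atTop 0] with n hn
      refine (div_le_iff₀ ((lowerBound_pos hb hr hn).trans_le (hLe n hn))).2 ((hdL n hn).trans ?_)
      exact mul_le_mul_of_nonneg_left (hLe n hn) (Real.rpow_nonneg hb0.le _)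
  · have hup := hone.mul hlim
    rw [one_mul] at hup
    refine tendsto_of_tendsto_of_tendsto_of_le_of_le' hlim hup ?_ ?_
    · filter_upwards [eventually_ne_atTop 0] with n hn
      exact mul_le_mul_of_nonneg_left (hLe n hn) n.cast_nonneg
    · filter_upwards [eventually_ne_atTop 0] with n hn
      rw [mul_left_comm]
      exact mul_le_mul_of_nonneg_left ((hed n hn).trans (hdL n hn)) n.cast_nonneg

end BenfordApprox
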